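/- Let G be a group generated by a finite set S, with word metric d_S, and let G act by isometries on a metric space (X,d). Let H ⊆ X and suppose the action is acylindrical along H. Fix a basepoint x₀ ∈ X and let π : G → X be the orbit map π(g) = g·x₀. Then for every r ≥ 0 there exists R ≥ 0 such that for all x, y ∈ H with d(x,y) ≥ R, the sets π⁻¹(B_r(x)) and π⁻¹(B_r(y)) are geometrically separated in (G, d_S): for every D ≥ 0, the set N_D(π⁻¹(B_r(x))) ∩ π⁻¹(B_r(y)) has finite diameter with respect to d_S, where the neighbourhood N_D is taken with respect to d_S and B_r(·) denotes the closed ball of radius r in X. -/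

import Mathlib

/-- The word metric on a group `G` with respect to a generating set `Y`:
`wordDist Y g h` is the least length of a word in `Y ∪ Y⁻¹` representing `g⁻¹ * h`. -/
noncomputable def wordDist {G : Type*} [Group G] (Y : Set G) (g h : G) : ℕ :=
  sInf {n : ℕ | ∃ w : List G, w.length = n ∧ (∀ t ∈ w, t ∈ Y ∪ Y⁻¹) ∧ w.prod = g⁻¹ * h}

theorem exists_word_length_eq_wordDist {G : Type*} [Group G] {Y : Set G}
    (hY : Subgroup.closure Y = ⊤) (g h : G) :
    ∃ w : List G, w.length = wordDist Y g h ∧ (∀ t ∈ w, t ∈ Y ∪ Y⁻¹) ∧ w.prod = g⁻¹ * h := by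
  refine Nat.sInf_mem (s := {n : ℕ | ∃ w : List G, w.length = n ∧ (∀ t ∈ w, t ∈ Y ∪ Y⁻¹) ∧
    w.prod = g⁻¹ * h}) ?_
  have hmem : g⁻¹ * h ∈ Submonoid.closure (Y ∪ Y⁻¹) := by
    rw [← Subgroup.closure_toSubmonoid, hY]
    exact Subgroup.mem_top _
  obtain ⟨w, hw, hprod⟩ := Submonoid.exists_list_of_mem_closure hmem
  exact ⟨w.length, w, rfl, hw, hprod⟩

theorem finite_list_prod_of_length_le {M : Type*} [Monoid M] {T : Set M} (hT : T.Finite) (n : ℕ) :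
    {u : M | ∃ w : List M, w.length ≤ n ∧ (∀ t ∈ w, t ∈ T) ∧ w.prod = u}.Finite := by
  have : Finite T := hT
  refine ((List.finite_length_le T n).image fun w => (w.map Subtype.val).prod).subset ?_
  rintro u ⟨w, hw, hwT, rfl⟩
  lift w to List T using hwT
  exact ⟨w, by simpa using hw, rfl⟩

/-- In a group generated by a finite set, balls in the word metric are finite. -/
theorem finite_setOf_wordDist_le {G : Type*} [Group G] {Y : Set G} (hfin : Y.Finite)
    (hY : Subgroup.closure Y = ⊤) (D : ℝ) :
    {u : G | ∃ g p : G, (wordDist Y g p : ℝ) ≤ D ∧ g⁻¹ * p = u}.Finite := by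
  refine (finite_list_prod_of_length_le (hfin.union hfin.inv) ⌊D⌋₊).subset ?_
  rintro u ⟨g, p, hgp, rfl⟩
  obtain ⟨w, hlen, hw, hprod⟩ := exists_word_length_eq_wordDist hY g p
  exact ⟨w, hlen ▸ Nat.le_floor hgp, hw, hprod⟩

theorem dist_mul_inv_smul_le {G X : Type*} [Group G] [MetricSpace X] [MulAction G X]
    (hiso : ∀ (g : G) (x y : X), dist (g • x) (g • y) = dist x y) {a b : G} {x z : X} {r : ℝ}
    (ha : dist (a • z) x ≤ r) (hb : dist (b • z) x ≤ r) :
    dist x ((b * a⁻¹) • x) ≤ 2 * r := by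
  have h : dist (b • z) ((b * a⁻¹) • x) = dist (a • z) x := by
    rw [← hiso (b * a⁻¹) (a • z) x, smul_smul, inv_mul_cancel_right]
  linarith [dist_triangle_left x ((b * a⁻¹) • x) (b • z)]

/-- If only finitely many group elements move both `x` and `y` by at most `2 * r`, then only
finitely many elements move `z` near `x` and `z'` near `y`. -/
theorem finite_setOf_dist_smul_le {G X : Type*} [Group G] [MetricSpace X] [MulAction G X]
    (hiso : ∀ (g : G) (x y : X), dist (g • x) (g • y) = dist x y) {x y : X} {r : ℝ}
    (hfin : {g : G | dist x (g • x) ≤ 2 * r ∧ dist y (g • y) ≤ 2 * r}.Finite) (z z' : X) :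
    {g : G | dist (g • z) x ≤ r ∧ dist (g • z') y ≤ r}.Finite := by
  obtain hempty | ⟨a, ha⟩ := Set.eq_empty_or_nonempty
    {g : G | dist (g • z) x ≤ r ∧ dist (g • z') y ≤ r}
  · simp [hempty]
  · refine (hfin.image (· * a)).subset fun b hb => ⟨b * a⁻¹, ?_, inv_mul_cancel_right b a⟩
    exact ⟨dist_mul_inv_smul_le hiso ha.1 hb.1, dist_mul_inv_smul_le hiso ha.2 hb.2⟩

/-- if a finitely generated group `G` acts by isometries on a metric space `X`
acylindrically along `H ⊆ X`, then for every `r ≥ 0` there is `R ≥ 0` such that for all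
`x, y ∈ H` with `d(x,y) ≥ R`, the preimages under the orbit map of the closed `r`-balls
around `x` and `y` are geometrically separated in the word metric on `G`. -/
theorem geom_sep_fibres_of_acylindrical
    {G X : Type*} [Group G] [MetricSpace X] [MulAction G X]
    (hiso : ∀ (g : G) (x y : X), dist (g • x) (g • y) = dist x y)
    (S : Finset G) (hS : Subgroup.closure (S : Set G) = ⊤)
    (H : Set X)
    (hacyl : ∀ r : ℝ, 0 ≤ r → ∃ R : ℝ, 0 ≤ R ∧ ∀ x ∈ H, ∀ y ∈ H, R ≤ dist x y →
      {g : G | dist x (g • x) ≤ r ∧ dist y (g • y) ≤ r}.Finite)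
    (x₀ : X) :
    ∀ r : ℝ, 0 ≤ r → ∃ R : ℝ, 0 ≤ R ∧ ∀ x ∈ H, ∀ y ∈ H, R ≤ dist x y →
      ∀ D : ℝ, 0 ≤ D → ∃ B : ℝ, 0 ≤ B ∧
        ∀ a ∈ {g : G | ∃ p : G, dist (p • x₀) x ≤ r ∧ (wordDist (S : Set G) g p : ℝ) ≤ D} ∩
              {g : G | dist (g • x₀) y ≤ r},
        ∀ b ∈ {g : G | ∃ p : G, dist (p • x₀) x ≤ r ∧ (wordDist (S : Set G) g p : ℝ) ≤ D} ∩
              {g : G | dist (g • x₀) y ≤ r},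
          (wordDist (S : Set G) a b : ℝ) ≤ B := by
  intro r hr
  obtain ⟨R, hR, hfin⟩ := hacyl (2 * r) (by positivity)
  refine ⟨R, hR, fun x hx y hy hxy D _ => ?_⟩
  set A : Set G := {g : G | ∃ p : G, dist (p • x₀) x ≤ r ∧ (wordDist (S : Set G) g p : ℝ) ≤ D} ∩
    {g : G | dist (g • x₀) y ≤ r}
  have hA : A.Finite := by
    refine ((finite_setOf_wordDist_le S.finite_toSet hS D).biUnion fun u _ =>
      finite_setOf_dist_smul_le hiso (hfin x hx y hy hxy) (u • x₀) x₀).subset ?_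
    rintro g ⟨⟨p, hp, hgp⟩, hg⟩
    refine Set.mem_biUnion (x := g⁻¹ * p) ⟨g, p, hgp, rfl⟩ ⟨?_, hg⟩
    rwa [smul_smul, mul_inv_cancel_left]
  obtain ⟨B, hB⟩ := ((hA.prod hA).image fun q => wordDist (S : Set G) q.1 q.2).bddAbove
  exact ⟨B, B.cast_nonneg, fun a ha b hb =>
    Nat.cast_le.mpr (hB ⟨(a, b), ⟨ha, hb⟩, rfl⟩)⟩
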